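/- Let ω : ℝ → ℝ be continuous on I = (−1,1) with ω(x) ≥ 1 for all x ∈ I and ∫_I ω dx < ∞. Let S ⊆ I be a finite set and let u : ℝ → ℝ be bounded on I, locally absolutely continuous on I∖S with a.e. derivative u′ satisfying ∫_I |u′|² ω dx < ∞, and such that at every x ∈ S the one-sided limits u(x⁻) and u(x⁺) exist. Then for every sequence of positive reals εₙ → 0 there exist functions uₙ, vₙ : ℝ → ℝ, locally absolutely continuous on I with a.e. derivatives gₙ, hₙ, such that 0 ≤ vₙ ≤ 1 on I, ∫_I |uₙ − u| ω dx → 0, ∫_I |vₙ − 1| dx → 0, and limsup_{n→∞} ( ∫_I vₙ² gₙ² ω dx + ∫_I [ (εₙ/2) hₙ² + (1/(2εₙ)) (vₙ − 1)² ] ω dx ) ≤ ∫_I |u′|² ω dx + Σ_{x ∈ S} ω(x), where all energy integrals are Lebesgue integrals with values in [0,∞]. -/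

import Mathlib

open MeasureTheory Filter Set
open scoped ENNReal

/-- `f` is absolutely continuous on `[a, b]` with a.e. derivative `f'`, encoded via the
fundamental theorem of calculus for the Lebesgue integral. -/
def ACderivOn (f f' : ℝ → ℝ) (a b : ℝ) : Prop :=
  IntervalIntegrable f' volume a b ∧
    ∀ x ∈ Set.Icc a b, f x = f a + ∫ t in a..x, f' t

/-- `f` is locally absolutely continuous on the open set `U` with a.e. derivative `f'`:
it is absolutely continuous with derivative `f'` on every compact subinterval of `U`. -/
def LocACOn (f f' : ℝ → ℝ) (U : Set ℝ) : Prop :=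
  ∀ a b : ℝ, a ≤ b → Set.Icc a b ⊆ U → ACderivOn f f' a b


open Topology

lemma ACderivOn.of_ae_hasDerivAt {f g : ℝ → ℝ} {a b : ℝ} (hab : a ≤ b)
    (hf : AbsolutelyContinuousOnInterval f a b)
    (hg : ∀ᵐ x, x ∈ uIcc a b → HasDerivAt f (g x) x) : ACderivOn f g a b := by
  have hae : ∀ᵐ x, x ∈ uIcc a b → deriv f x = g x := by
    filter_upwards [hg] with x hx hxI using (hx hxI).deriv
  refine ⟨hf.intervalIntegrable_deriv.congr_ae ?_, fun x hx => ?_⟩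
  · rw [EventuallyEq, ae_restrict_iff' measurableSet_uIoc]
    filter_upwards [hae] with x hx hxI using hx (uIoc_subset_uIcc hxI)
  · have hsub : uIcc a x ⊆ uIcc a b := uIcc_subset_uIcc_left (uIcc_of_le hab ▸ hx)
    have h1 := (hf.mono hsub).integral_deriv_eq_sub
    have h2 : ∫ t in a..x, deriv f t = ∫ t in a..x, g t := by
      apply intervalIntegral.integral_congr_ae
      filter_upwards [hae] with t ht htI using ht (hsub (uIoc_subset_uIcc htI))
    rw [← h2, h1]; ring

lemma ACderivOn.absolutelyContinuousOnInterval {f g : ℝ → ℝ} {a b : ℝ} (hab : a ≤ b)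
    (h : ACderivOn f g a b) : AbsolutelyContinuousOnInterval f a b := by
  have h1 := h.1.absolutelyContinuousOnInterval_intervalIntegral (c := a) left_mem_uIcc
  rw [absolutelyContinuousOnInterval_iff] at h1 ⊢
  intro η hη
  obtain ⟨δ, hδ, H⟩ := h1 η hη
  refine ⟨δ, hδ, fun E hE hEδ => ?_⟩
  convert H E hE hEδ using 2 with i hi
  have hi' := hE.1 i hi
  rw [uIcc_of_le hab] at hi'
  rw [h.2 _ hi'.1, h.2 _ hi'.2, dist_add_left]

lemma ACderivOn.ae_hasDerivAt {f g : ℝ → ℝ} {a b : ℝ} (hab : a ≤ b)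
    (h : ACderivOn f g a b) : ∀ᵐ x, x ∈ uIcc a b → HasDerivAt f (g x) x := by
  filter_upwards [h.1.ae_hasDerivAt_integral, Measure.ae_ne volume a, Measure.ae_ne volume b]
    with x hx hxa hxb hxI
  have hd := (hx hxI a left_mem_uIcc).const_add (f a)
  refine hd.congr_of_eventuallyEq ?_
  rw [uIcc_of_le hab] at hxI
  filter_upwards [Icc_mem_nhds (lt_of_le_of_ne hxI.1 (Ne.symm hxa)) (lt_of_le_of_ne hxI.2 hxb)]
    with y hy using h.2 y hy

lemma ACderivOn.mul {f f' g g' : ℝ → ℝ} {a b : ℝ} (hab : a ≤ b)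
    (hf : ACderivOn f f' a b) (hg : ACderivOn g g' a b) :
    ACderivOn (fun x => f x * g x) (fun x => f' x * g x + f x * g' x) a b := by
  refine .of_ae_hasDerivAt hab ((hf.absolutelyContinuousOnInterval hab).fun_mul
    (hg.absolutelyContinuousOnInterval hab)) ?_
  filter_upwards [hf.ae_hasDerivAt hab, hg.ae_hasDerivAt hab] with x h1 h2 hx
    using (h1 hx).mul (h2 hx)

lemma LipschitzWith.acDerivOn {f g : ℝ → ℝ} {K : NNReal} {a b : ℝ} (hab : a ≤ b)
    (hf : LipschitzWith K f) (hg : ∀ᵐ x, HasDerivAt f (g x) x) : ACderivOn f g a b :=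
  .of_ae_hasDerivAt hab hf.lipschitzOnWith.absolutelyContinuousOnInterval
    (hg.mono fun _ hx _ => hx)

lemma ACderivOn.sub_eq_integral {f g : ℝ → ℝ} {c d x y : ℝ} (h : ACderivOn f g c d)
    (hx : x ∈ Icc c d) (hy : y ∈ Icc c d) : f y - f x = ∫ t in x..y, g t := by
  have hcd : c ≤ d := hx.1.trans hx.2
  have hi : ∀ z ∈ Icc c d, IntervalIntegrable g volume c z := fun z hz =>
    h.1.mono_set (uIcc_subset_uIcc_left (uIcc_of_le hcd ▸ hz))
  rw [h.2 x hx, h.2 y hy, ← intervalIntegral.integral_interval_sub_left (hi y hy) (hi x hx)]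
  ring

/-- Absolute continuity near every point implies local absolute continuity. -/
lemma LocACOn.of_forall_exists {f g : ℝ → ℝ} {U : Set ℝ}
    (h : ∀ x ∈ U, ∃ c d, c < x ∧ x < d ∧ ACderivOn f g c d) : LocACOn f g U := by
  intro a b hab hU
  have hint : IntervalIntegrable g volume a b := by
    rw [intervalIntegrable_iff_integrableOn_Icc_of_le hab]
    have : LocallyIntegrableOn g (Icc a b) := by
      intro x hx
      obtain ⟨c, d, hcx, hxd, hcd⟩ := h x (hU hx)
      refine ⟨Icc c d, mem_nhdsWithin_of_mem_nhds (Icc_mem_nhds hcx hxd), ?_⟩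
      exact (intervalIntegrable_iff_integrableOn_Icc_of_le (hcx.trans hxd).le).1 hcd.1
    exact this.integrableOn_isCompact isCompact_Icc
  refine ⟨hint, ?_⟩
  have hi : ∀ z ∈ Icc a b, IntervalIntegrable g volume a z := fun z hz =>
    hint.mono_set (uIcc_subset_uIcc_left (uIcc_of_le hab ▸ hz))
  set H : ℝ → ℝ := fun x => f x - ∫ t in a..x, g t with hH
  have hloc : ∀ x ∈ Icc a b, H =ᶠ[𝓝[Icc a b] x] fun _ => H x := by
    intro x hx
    obtain ⟨c, d, hcx, hxd, hcd⟩ := h x (hU hx)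
    filter_upwards [self_mem_nhdsWithin, mem_nhdsWithin_of_mem_nhds (Icc_mem_nhds hcx hxd)]
      with y hy hy'
    have h1 := hcd.sub_eq_integral ⟨hcx.le, hxd.le⟩ hy'
    rw [← intervalIntegral.integral_interval_sub_left (hi y hy) (hi x hx)] at h1
    simp only [hH]; linarith
  have key := constant_of_has_deriv_right_zero (f := H) (a := a) (b := b)
    (fun x hx => (continuousWithinAt_const (b := H x)).congr_of_eventuallyEq (hloc x hx) rfl)
    (fun x hx => by
      have hd : HasDerivWithinAt H 0 (Icc a b) x :=
        (hasDerivWithinAt_const x _ (H x)).congr_of_eventuallyEq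
          (hloc x (Ico_subset_Icc_self hx)) rfl
      exact hd.mono_of_mem_nhdsWithin (mem_of_superset (Icc_mem_nhdsGE hx.2)
        (Icc_subset_Icc_left hx.1)))
  intro x hx
  have := key x hx
  simp only [hH, intervalIntegral.integral_same] at this
  linarith

lemma abs_exp_neg_sub_exp_neg_le {a b : ℝ} (ha : 0 ≤ a) (hb : 0 ≤ b) :
    |Real.exp (-a) - Real.exp (-b)| ≤ |a - b| := by
  wlog hab : a ≤ b generalizing a b
  · rw [abs_sub_comm, abs_sub_comm a]
    exact this hb ha (le_of_not_ge hab)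
  have h1 : Real.exp (-b) = Real.exp (-a) * Real.exp (-(b - a)) := by
    rw [← Real.exp_add]; ring_nf
  have h2 : 1 - (b - a) ≤ Real.exp (-(b - a)) := by
    linarith [Real.add_one_le_exp (-(b - a))]
  have h3 : Real.exp (-a) ≤ 1 := by simpa using ha
  have h4 : Real.exp (-b) ≤ Real.exp (-a) := by simpa using hab
  rw [abs_of_nonneg (by linarith), abs_sub_comm, abs_of_nonneg (by linarith)]
  nlinarith [Real.exp_pos (-a)]

lemma integral_exp_neg_two_mul_abs : ∫ x : ℝ, Real.exp (-(2 * |x|)) = 1 := by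
  rw [integral_comp_abs (f := fun x => Real.exp (-(2 * x)))]
  have := integral_exp_mul_Ioi (a := -2) (by norm_num) 0
  simp only [neg_mul] at this
  rw [this]; norm_num

/-- The rescaled exponentials concentrate at `s`. -/
lemma tendsto_lintegral_exp_peak {ω : ℝ → ℝ} {U : Set ℝ} (hU : IsOpen U)
    (hωc : ContinuousOn ω U) (hω0 : ∀ x ∈ U, 0 ≤ ω x) (hωi : IntegrableOn ω U)
    {s : ℝ} (hs : s ∈ U) {ι : Type*} {l : Filter ι} {ε : ι → ℝ} (hεpos : ∀ n, 0 < ε n)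
    (hε0 : Tendsto ε l (𝓝 0)) :
    Tendsto (fun n => ∫⁻ x in U, ENNReal.ofReal
      (Real.exp (2 * ε n) * ((ε n)⁻¹ * Real.exp (-(2 * |x - s| / ε n))) * ω x)) l
      (𝓝 (ENNReal.ofReal (ω s))) := by
  have hc : Tendsto (fun n => (ε n)⁻¹) l atTop :=
    Tendsto.inv_tendsto_nhdsGT_zero (tendsto_nhdsWithin_iff.2 ⟨hε0, .of_forall hεpos⟩)
  have hdecay : Tendsto (fun x : ℝ => ‖x‖ ^ Module.finrank ℝ ℝ * Real.exp (-(2 * |x|)))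
      (Bornology.cobounded ℝ) (𝓝 0) := by
    have h1 := (Real.tendsto_pow_mul_exp_neg_atTop_nhds_zero 1).comp
      (tendsto_norm_cobounded_atTop (E := ℝ))
    refine squeeze_zero (fun x => by positivity) (fun x => ?_) h1
    simp only [Module.finrank_self, Function.comp, Real.norm_eq_abs]
    gcongr
    linarith [abs_nonneg x]
  have hpeak := (tendsto_integral_comp_smul_smul_of_integrable' (μ := volume)
    (φ := fun x : ℝ => Real.exp (-(2 * |x|))) (fun x => (Real.exp_pos _).le)
    integral_exp_neg_two_mul_abs hdecay (g := U.indicator ω) (x₀ := s)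
    ((integrable_indicator_iff hU.measurableSet).2 hωi)
    ((hωc.continuousAt (hU.mem_nhds hs)).congr
      (by filter_upwards [hU.mem_nhds hs] with x hx using (indicator_of_mem hx ω).symm))).comp hc
  have hexp : Tendsto (fun n => Real.exp (2 * ε n)) l (𝓝 1) := by
    have := (Real.continuous_exp.tendsto _).comp (hε0.const_mul 2)
    simpa [Function.comp_def] using this
  have hlim := (ENNReal.continuous_ofReal.tendsto _).comp (hexp.mul hpeak)
  rw [one_mul, indicator_of_mem hs] at hlim
  refine hlim.congr fun n => ?_
  have hn := hεpos n
  simp only [Function.comp, Module.finrank_self, pow_one, smul_eq_mul]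
  rw [← integral_const_mul]
  have heq : (fun x => Real.exp (2 * ε n) * ((ε n)⁻¹ * Real.exp (-(2 * |(ε n)⁻¹ * (s - x)|)) *
      U.indicator ω x)) = U.indicator (fun x => Real.exp (2 * ε n) *
        ((ε n)⁻¹ * Real.exp (-(2 * |x - s| / ε n))) * ω x) := by
    ext x
    by_cases hx : x ∈ U
    · simp only [indicator_of_mem hx]
      rw [abs_mul, abs_of_pos (inv_pos.2 hn), abs_sub_comm, div_eq_mul_inv]
      ring_nf
    · simp [indicator_of_notMem hx]
  rw [heq, integral_indicator hU.measurableSet]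
  refine ofReal_integral_eq_lintegral_ofReal ?_ ?_
  · refine Integrable.bdd_mul (c := Real.exp (2 * ε n) * (ε n)⁻¹) hωi
      (by fun_prop) (.of_forall fun x => ?_)
    rw [Real.norm_of_nonneg (by positivity)]
    gcongr
    refine mul_le_of_le_one_right (by positivity) ?_
    simpa using (by positivity : 0 ≤ 2 * |x - s| / ε n)
  · filter_upwards [ae_restrict_mem hU.measurableSet] with x hx
    have := hω0 x hx
    simp only [Pi.zero_apply]; positivity

open Metric

/-- A Lipschitz cutoff vanishing `ε ^ 2 / 2`-close to `S` and equal to `1` at distance at least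
`ε ^ 2` from `S`. -/
noncomputable def cutoff (S : Set ℝ) (ε x : ℝ) : ℝ := max 0 (min 1 (2 / ε ^ 2 * infDist x S - 1))

/-- The distance to the `ε ^ 2`-neighbourhood of `S`. -/
noncomputable def plateauDist (S : Set ℝ) (ε x : ℝ) : ℝ := max 0 (infDist x S - ε ^ 2)

/-- The optimal phase-field profile: it vanishes `ε ^ 2`-close to `S` and tends exponentially to
`1` away from `S`. -/
noncomputable def phase (S : Set ℝ) (ε x : ℝ) : ℝ := 1 - Real.exp (-(plateauDist S ε x / ε))

/-- The a.e. derivative of `phase`. -/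
noncomputable def phaseDeriv (S : Set ℝ) (ε x : ℝ) : ℝ :=
  Real.exp (-(plateauDist S ε x / ε)) * (deriv (plateauDist S ε) x / ε)

section

variable {S : Set ℝ} {ε x : ℝ}

lemma cutoff_nonneg : 0 ≤ cutoff S ε x := le_max_left _ _

lemma cutoff_le_one : cutoff S ε x ≤ 1 := max_le zero_le_one (min_le_left _ _)

lemma cutoff_eq_one (hε : 0 < ε) (h : ε ^ 2 ≤ infDist x S) : cutoff S ε x = 1 := by
  have h1 : 1 ≤ infDist x S / ε ^ 2 := (one_le_div (by positivity)).2 h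
  have h2 : 1 ≤ 2 / ε ^ 2 * infDist x S - 1 := by
    rw [div_mul_eq_mul_div, mul_div_assoc]; linarith
  rw [cutoff, min_eq_left h2, max_eq_right zero_le_one]

lemma cutoff_eq_zero (hε : 0 < ε) (h : infDist x S < ε ^ 2 / 2) : cutoff S ε x = 0 := by
  have h1 : infDist x S / ε ^ 2 ≤ 1 / 2 := (div_le_iff₀ (by positivity)).2 (by linarith)
  have h2 : 2 / ε ^ 2 * infDist x S - 1 ≤ 0 := by
    rw [div_mul_eq_mul_div, mul_div_assoc]; linarith
  rw [cutoff, max_eq_left ((min_le_right _ _).trans h2)]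

lemma continuous_cutoff : Continuous (cutoff S ε) := by
  unfold cutoff; fun_prop

lemma exists_lipschitzWith_cutoff : ∃ K, LipschitzWith K (cutoff S ε) := by
  have h1 : LipschitzWith (2 / ε ^ 2).toNNReal fun x => 2 / ε ^ 2 * infDist x S - 1 := by
    refine .of_dist_le_mul fun x y => ?_
    have := (lipschitz_infDist_pt S).dist_le_mul x y
    rw [Real.coe_toNNReal _ (by positivity), dist_sub_right, Real.dist_eq, ← mul_sub, abs_mul,
      abs_of_nonneg (by positivity)]
    gcongr
    simpa [Real.dist_eq] using this
  exact ⟨_, (h1.const_min 1).const_max 0⟩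

lemma deriv_cutoff_of_lt_infDist (hε : 0 < ε) (h : ε ^ 2 < infDist x S) :
    deriv (cutoff S ε) x = 0 := by
  have : cutoff S ε =ᶠ[𝓝 x] fun _ => 1 := by
    filter_upwards [(continuous_infDist_pt S).continuousAt.eventually_const_lt h] with y hy
      using cutoff_eq_one hε hy.le
  rw [this.deriv_eq, deriv_const]

lemma deriv_cutoff_of_infDist_lt (hε : 0 < ε) (h : infDist x S < ε ^ 2 / 2) :
    deriv (cutoff S ε) x = 0 := by
  have : cutoff S ε =ᶠ[𝓝 x] fun _ => 0 := by
    filter_upwards [(continuous_infDist_pt S).continuousAt.eventually_lt_const h] with y hy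
      using cutoff_eq_zero hε hy
  rw [this.deriv_eq, deriv_const]

lemma plateauDist_nonneg : 0 ≤ plateauDist S ε x := le_max_left _ _

lemma lipschitzWith_plateauDist : LipschitzWith 1 (plateauDist S ε) := by
  have h1 : LipschitzWith 1 fun x => infDist x S - ε ^ 2 := by
    refine .of_dist_le_mul fun x y => ?_
    rw [dist_sub_right]
    exact (lipschitz_infDist_pt S).dist_le_mul x y
  exact h1.const_max 0

lemma phase_eq_zero (h : infDist x S ≤ ε ^ 2) : phase S ε x = 0 := by
  simp [phase, plateauDist, h]

lemma phase_nonneg (hε : 0 < ε) : 0 ≤ phase S ε x := by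
  have : 0 ≤ plateauDist S ε x / ε := div_nonneg plateauDist_nonneg hε.le
  simpa [phase] using this

lemma phase_le_one : phase S ε x ≤ 1 := by
  simpa [phase] using (Real.exp_pos _).le

lemma continuous_phase : Continuous (phase S ε) := by
  unfold phase plateauDist; fun_prop

lemma lipschitzWith_phase (hε : 0 < ε) : LipschitzWith (ε⁻¹).toNNReal (phase S ε) := by
  refine .of_dist_le_mul fun x y => ?_
  rw [Real.coe_toNNReal _ (by positivity), Real.dist_eq, phase, phase, sub_sub_sub_cancel_left,
    abs_sub_comm]
  refine (abs_exp_neg_sub_exp_neg_le (div_nonneg plateauDist_nonneg hε.le)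
    (div_nonneg plateauDist_nonneg hε.le)).trans ?_
  rw [← sub_div, abs_div, abs_of_pos hε, div_eq_inv_mul]
  gcongr
  simpa [Real.dist_eq] using (lipschitzWith_plateauDist (S := S) (ε := ε)).dist_le_mul x y

lemma locACOn_phase (hε : 0 < ε) (U : Set ℝ) : LocACOn (phase S ε) (phaseDeriv S ε) U := by
  intro a b hab _
  refine (lipschitzWith_phase hε).acDerivOn hab ?_
  filter_upwards [(lipschitzWith_plateauDist (S := S) (ε := ε)).ae_differentiableAt_real]
    with x hx
  have : HasDerivAt (phase S ε) _ x := ((hx.hasDerivAt.div_const ε).neg.exp).const_sub 1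
  exact this.congr_deriv (by simp [phaseDeriv])

/-- The Modica–Mortola density of the phase field is controlled by the sum of the peaks at the
points of `S`. -/
lemma exists_density_phase_le (hS : S.Finite) (hne : S.Nonempty) (hε : 0 < ε) (x : ℝ) :
    ∃ s ∈ S, ε / 2 * phaseDeriv S ε x ^ 2 + 1 / (2 * ε) * (phase S ε x - 1) ^ 2 ≤
      Real.exp (2 * ε) * (ε⁻¹ * Real.exp (-(2 * |x - s| / ε))) := by
  obtain ⟨s, hs, hxs⟩ := hS.isCompact.exists_infDist_eq_dist hne x
  refine ⟨s, hs, ?_⟩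
  rw [Real.dist_eq] at hxs
  have hd : deriv (plateauDist S ε) x ^ 2 ≤ 1 := by
    rw [sq_le_one_iff_abs_le_one]
    simpa using norm_deriv_le_of_lipschitz (lipschitzWith_plateauDist (S := S) (ε := ε)) (x₀ := x)
  set e := Real.exp (-(plateauDist S ε x / ε)) with he
  have h1 : ε / 2 * phaseDeriv S ε x ^ 2 + 1 / (2 * ε) * (phase S ε x - 1) ^ 2 =
      ε⁻¹ * e ^ 2 * ((deriv (plateauDist S ε) x ^ 2 + 1) / 2) := by
    rw [phaseDeriv, phase, ← he]; field_simp; ring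
  have h2 : e ^ 2 ≤ Real.exp (2 * ε) * Real.exp (-(2 * |x - s| / ε)) := by
    rw [he, ← Real.exp_nat_mul, ← Real.exp_add, Real.exp_le_exp, ← hxs]
    have : (infDist x S - ε ^ 2) / ε ≤ plateauDist S ε x / ε := by
      gcongr; exact le_max_right _ _
    have h3 : (infDist x S - ε ^ 2) / ε = infDist x S / ε - ε := by field_simp
    rw [mul_div_assoc]
    push_cast
    linarith
  rw [h1]
  calc ε⁻¹ * e ^ 2 * ((deriv (plateauDist S ε) x ^ 2 + 1) / 2) ≤ ε⁻¹ * e ^ 2 :=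
        mul_le_of_le_one_right (by positivity) (by linarith)
    _ ≤ ε⁻¹ * (Real.exp (2 * ε) * Real.exp (-(2 * |x - s| / ε))) := by gcongr
    _ = _ := by ring

/-- Truncating near `S` makes a function that is absolutely continuous off `S` absolutely
continuous. -/
lemma LocACOn.mul_cutoff {u u' : ℝ → ℝ} {U : Set ℝ} (hU : IsOpen U) (hS : IsClosed S)
    (hε : 0 < ε) (hu : LocACOn u u' (U \ S)) :
    LocACOn (fun x => u x * cutoff S ε x)
      (fun x => u' x * cutoff S ε x + u x * deriv (cutoff S ε) x) U := by
  refine .of_forall_exists fun x hx => ?_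
  by_cases hxS : x ∈ S
  · have hopen : {y | infDist y S < ε ^ 2 / 2} ∈ 𝓝 x :=
      (isOpen_lt (continuous_infDist_pt S) continuous_const).mem_nhds
        (by simp [infDist_zero_of_mem hxS]; positivity)
    obtain ⟨r, hr, hball⟩ := nhds_basis_closedBall.mem_iff.1 hopen
    rw [Real.closedBall_eq_Icc] at hball
    have hle : x - r ≤ x + r := by linarith
    have hzero : ∀ y ∈ Icc (x - r) (x + r),
        u' y * cutoff S ε y + u y * deriv (cutoff S ε) y = 0 := fun y hy => by
      rw [cutoff_eq_zero hε (hball hy), deriv_cutoff_of_infDist_lt hε (hball hy)]; ring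
    refine ⟨x - r, x + r, by linarith, by linarith, ?_, fun y hy => ?_⟩
    · refine (intervalIntegrable_const (c := (0 : ℝ))).congr fun y hy => ?_
      exact (hzero y (by
        simpa [uIcc_of_le hle] using uIoc_subset_uIcc hy)).symm
    · have hint : ∫ t in (x - r)..y, (u' t * cutoff S ε t + u t * deriv (cutoff S ε) t) = 0 := by
        rw [intervalIntegral.integral_congr (g := fun _ => (0 : ℝ))]
        · simp
        · intro t ht
          rw [uIcc_of_le hy.1] at ht
          exact hzero t ⟨ht.1, ht.2.trans hy.2⟩
      simp only [hint, cutoff_eq_zero hε (hball hy),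
        cutoff_eq_zero hε (hball (left_mem_Icc.2 hle)), mul_zero, add_zero]
  · obtain ⟨r, hr, hball⟩ := nhds_basis_closedBall.mem_iff.1
      ((hU.sdiff hS).mem_nhds ⟨hx, hxS⟩)
    rw [Real.closedBall_eq_Icc] at hball
    have hle : x - r ≤ x + r := by linarith
    obtain ⟨K, hK⟩ := exists_lipschitzWith_cutoff (S := S) (ε := ε)
    exact ⟨x - r, x + r, by linarith, by linarith, (hu _ _ hle hball).mul hle
      (hK.acDerivOn hle (hK.ae_differentiableAt_real.mono fun _ h => h.hasDerivAt))⟩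

lemma phase_sq_mul_deriv_sq_le (hε : 0 < ε) (a b : ℝ) :
    phase S ε x ^ 2 * (a * cutoff S ε x + b * deriv (cutoff S ε) x) ^ 2 ≤ a ^ 2 := by
  rcases le_or_gt (infDist x S) (ε ^ 2) with h | h
  · rw [phase_eq_zero h]; simp [sq_nonneg]
  · rw [cutoff_eq_one hε h.le, deriv_cutoff_of_lt_infDist hε h]
    have : phase S ε x ^ 2 ≤ 1 := pow_le_one₀ (phase_nonneg hε) phase_le_one
    simpa using mul_le_of_le_one_left (sq_nonneg a) this

end

lemma infDist_pos_of_finite {S : Set ℝ} (hS : S.Finite) (hne : S.Nonempty) {x : ℝ} (hx : x ∉ S) :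
    0 < infDist x S := (hS.isClosed.notMem_iff_infDist_pos hne).1 hx

/-- The truncated functions converge in the weighted `L¹` norm. -/
lemma tendsto_lintegral_mul_cutoff {ω u : ℝ → ℝ} {S U : Set ℝ} (hU : MeasurableSet U)
    (hω0 : ∀ x ∈ U, 0 ≤ ω x) (hωi : IntegrableOn ω U) (hS : S.Finite) (hne : S.Nonempty)
    {M : ℝ} (hM : ∀ x ∈ U, |u x| ≤ M) {ε : ℕ → ℝ} (hεpos : ∀ n, 0 < ε n)
    (hε0 : Tendsto ε atTop (𝓝 0)) :
    Tendsto (fun n => ∫⁻ x in U, ENNReal.ofReal (|u x * cutoff S (ε n) x - u x| * ω x)) atTop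
      (𝓝 0) := by
  have hsq : Tendsto (fun n => ε n ^ 2) atTop (𝓝 0) := by simpa using hε0.pow 2
  have key : Tendsto (fun n => ∫⁻ x in U,
      ENNReal.ofReal ((1 - cutoff S (ε n) x) * (M * ω x))) atTop (𝓝 (∫⁻ _ in U, 0)) := by
    refine tendsto_lintegral_of_dominated_convergence' (fun x => ENNReal.ofReal (M * ω x))
      (fun n => ?_) (fun n => ?_) ?_ ?_
    · exact ((continuous_const.sub continuous_cutoff).aemeasurable.mul
        (hωi.aemeasurable.const_mul M)).ennreal_ofReal
    · filter_upwards [ae_restrict_mem hU] with x hx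
      have h0 : 0 ≤ M * ω x := mul_nonneg ((abs_nonneg _).trans (hM x hx)) (hω0 x hx)
      exact ENNReal.ofReal_le_ofReal (mul_le_of_le_one_left h0
        (by linarith [cutoff_nonneg (S := S) (ε := ε n) (x := x)]))
    · exact (hωi.const_mul M).lintegral_lt_top.ne
    · filter_upwards [ae_restrict_of_ae (hS.countable.ae_notMem volume)] with x hx
      refine tendsto_const_nhds.congr' ?_
      filter_upwards [hsq.eventually_lt_const (infDist_pos_of_finite hS hne hx)] with n hn
      simp [cutoff_eq_one (hεpos n) hn.le]
  rw [lintegral_zero] at key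
  refine tendsto_of_tendsto_of_tendsto_of_le_of_le tendsto_const_nhds key (fun _ => zero_le)
    fun n => setLIntegral_mono' hU fun x hx => ENNReal.ofReal_le_ofReal ?_
  have h1 : u x * cutoff S (ε n) x - u x = -(u x * (1 - cutoff S (ε n) x)) := by ring
  have h2 : 0 ≤ 1 - cutoff S (ε n) x := sub_nonneg.2 cutoff_le_one
  rw [h1, abs_neg, abs_mul, abs_of_nonneg h2]
  have h3 := hM x hx
  have h4 := hω0 x hx
  calc |u x| * (1 - cutoff S (ε n) x) * ω x ≤ M * (1 - cutoff S (ε n) x) * ω x := by gcongr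
    _ = _ := by ring

/-- The phase fields converge to `1` in `L¹`. -/
lemma tendsto_lintegral_abs_phase_sub_one {S U : Set ℝ} (hU : volume U ≠ ⊤) (hS : S.Finite)
    (hne : S.Nonempty) {ε : ℕ → ℝ} (hεpos : ∀ n, 0 < ε n) (hε0 : Tendsto ε atTop (𝓝 0)) :
    Tendsto (fun n => ∫⁻ x in U, ENNReal.ofReal |phase S (ε n) x - 1|) atTop (𝓝 0) := by
  have hc : Tendsto (fun n => (ε n)⁻¹) atTop atTop :=
    Tendsto.inv_tendsto_nhdsGT_zero (tendsto_nhdsWithin_iff.2 ⟨hε0, .of_forall hεpos⟩)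
  have key : Tendsto (fun n => ∫⁻ x in U, ENNReal.ofReal |phase S (ε n) x - 1|) atTop
      (𝓝 (∫⁻ _ in U, 0)) := by
    refine tendsto_lintegral_of_dominated_convergence (fun _ => 1)
      (fun n => (continuous_phase.sub continuous_const).abs.measurable.ennreal_ofReal)
      (fun n => .of_forall fun x => ?_) (by simpa using hU) ?_
    · refine ENNReal.ofReal_le_one.2 (abs_le.2 ⟨?_, ?_⟩)
      · linarith [phase_nonneg (S := S) (x := x) (hεpos n)]
      · linarith [phase_le_one (S := S) (ε := ε n) (x := x)]
    · filter_upwards [ae_restrict_of_ae (hS.countable.ae_notMem volume)] with x hx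
      have hd := infDist_pos_of_finite hS hne hx
      have h1 : Tendsto (fun n => infDist x S * (ε n)⁻¹ - ε n) atTop atTop :=
        (hc.const_mul_atTop hd).atTop_add hε0.neg
      have h2 : Tendsto (fun n => plateauDist S (ε n) x / ε n) atTop atTop := by
        refine tendsto_atTop_mono (fun n => ?_) h1
        have hn := hεpos n
        calc infDist x S * (ε n)⁻¹ - ε n = (infDist x S - ε n ^ 2) / ε n := by field_simp
          _ ≤ plateauDist S (ε n) x / ε n := by gcongr; exact le_max_right _ _
      have h3 := (ENNReal.continuous_ofReal.tendsto _).comp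
        (Real.tendsto_exp_neg_atTop_nhds_zero.comp h2)
      rw [ENNReal.ofReal_zero] at h3
      refine h3.congr fun n => ?_
      simp [phase, abs_of_pos (Real.exp_pos _)]
  simpa using key

/-- Γ-limsup (recovery sequence) inequality for the one-dimensional weighted
Ambrosio–Tortorelli functionals with continuous weight `ω ≥ 1` on `I = (-1, 1)`. -/
theorem gamma_limsup_continuous_weight_1d
    (ω : ℝ → ℝ)
    (hωc : ContinuousOn ω (Set.Ioo (-1 : ℝ) 1))
    (hω1 : ∀ x ∈ Set.Ioo (-1 : ℝ) 1, 1 ≤ ω x)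
    (hωint : (∫⁻ x in Set.Ioo (-1 : ℝ) 1, ENNReal.ofReal (ω x)) < ⊤)
    (S : Set ℝ) (hS : S.Finite) (hSI : S ⊆ Set.Ioo (-1 : ℝ) 1)
    (u u' : ℝ → ℝ)
    (hubdd : ∃ M : ℝ, ∀ x ∈ Set.Ioo (-1 : ℝ) 1, |u x| ≤ M)
    (hu : LocACOn u u' (Set.Ioo (-1 : ℝ) 1 \ S))
    (hu'int : (∫⁻ x in Set.Ioo (-1 : ℝ) 1, ENNReal.ofReal ((u' x) ^ 2 * ω x)) < ⊤)
    (hjump : ∀ x ∈ S, ∃ l r : ℝ,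
      Tendsto u (nhdsWithin x (Set.Iio x)) (nhds l) ∧
      Tendsto u (nhdsWithin x (Set.Ioi x)) (nhds r))
    (ε : ℕ → ℝ) (hεpos : ∀ n, 0 < ε n) (hε0 : Tendsto ε atTop (nhds 0)) :
    ∃ un gn vn hn : ℕ → ℝ → ℝ,
      (∀ n, LocACOn (un n) (gn n) (Set.Ioo (-1 : ℝ) 1)) ∧
      (∀ n, LocACOn (vn n) (hn n) (Set.Ioo (-1 : ℝ) 1)) ∧
      (∀ n, ∀ x ∈ Set.Ioo (-1 : ℝ) 1, 0 ≤ vn n x ∧ vn n x ≤ 1) ∧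
      Tendsto (fun n => ∫⁻ x in Set.Ioo (-1 : ℝ) 1,
        ENNReal.ofReal (|un n x - u x| * ω x)) atTop (nhds 0) ∧
      Tendsto (fun n => ∫⁻ x in Set.Ioo (-1 : ℝ) 1,
        ENNReal.ofReal |vn n x - 1|) atTop (nhds 0) ∧
      Filter.limsup (fun n =>
          (∫⁻ x in Set.Ioo (-1 : ℝ) 1,
            ENNReal.ofReal ((vn n x) ^ 2 * (gn n x) ^ 2 * ω x)) +
          ∫⁻ x in Set.Ioo (-1 : ℝ) 1,
            ENNReal.ofReal (((ε n / 2) * (hn n x) ^ 2 +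
              (1 / (2 * ε n)) * (vn n x - 1) ^ 2) * ω x)) atTop ≤
        (∫⁻ x in Set.Ioo (-1 : ℝ) 1, ENNReal.ofReal ((u' x) ^ 2 * ω x)) +
          ∑ x ∈ hS.toFinset, ENNReal.ofReal (ω x) := by
  have hωi : IntegrableOn ω (Ioo (-1 : ℝ) 1) :=
    ⟨hωc.aestronglyMeasurable measurableSet_Ioo, by
      rw [hasFiniteIntegral_iff_ofReal]
      · exact hωint
      · filter_upwards [ae_restrict_mem measurableSet_Ioo] with x hx
          using zero_le_one.trans (hω1 x hx)⟩
  have hω0 : ∀ x ∈ Ioo (-1 : ℝ) 1, 0 ≤ ω x := fun x hx => zero_le_one.trans (hω1 x hx)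
  rcases S.eq_empty_or_nonempty with rfl | hne
  · refine ⟨fun _ => u, fun _ => u', fun _ _ => 1, fun _ _ => 0, fun _ => ?_, fun _ a b _ _ => ?_,
      fun _ _ _ => ⟨zero_le_one, le_rfl⟩, ?_, ?_, ?_⟩
    · simpa using hu
    · exact ⟨intervalIntegrable_const, by simp⟩
    · simp
    · simp
    · simp
  obtain ⟨M, hM⟩ := hubdd
  refine ⟨fun n x => u x * cutoff S (ε n) x,
    fun n x => u' x * cutoff S (ε n) x + u x * deriv (cutoff S (ε n)) x,
    fun n => phase S (ε n), fun n => phaseDeriv S (ε n),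
    fun n => hu.mul_cutoff isOpen_Ioo hS.isClosed (hεpos n), fun n => locACOn_phase (hεpos n) _,
    fun n x _ => ⟨phase_nonneg (hεpos n), phase_le_one⟩,
    tendsto_lintegral_mul_cutoff measurableSet_Ioo hω0 hωi hS hne hM hεpos hε0,
    tendsto_lintegral_abs_phase_sub_one (by simp) hS hne hεpos hε0, ?_⟩
  have hpeak := (tendsto_finsetSum hS.toFinset fun s hs =>
    tendsto_lintegral_exp_peak isOpen_Ioo hωc hω0 hωi (hSI (hS.mem_toFinset.1 hs)) hεpos
      hε0).const_add (∫⁻ x in Ioo (-1 : ℝ) 1, ENNReal.ofReal (u' x ^ 2 * ω x))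
  rw [← hpeak.limsup_eq]
  refine limsup_le_limsup (.of_forall fun n => add_le_add ?_ ?_)
  · refine setLIntegral_mono' measurableSet_Ioo fun x hx => ENNReal.ofReal_le_ofReal ?_
    exact mul_le_mul_of_nonneg_right (phase_sq_mul_deriv_sq_le (hεpos n) _ _) (hω0 x hx)
  · rw [← lintegral_finsetSum']
    · refine setLIntegral_mono' measurableSet_Ioo fun x hx => ?_
      obtain ⟨s, hs, hle⟩ := exists_density_phase_le hS hne (hεpos n) x
      refine (ENNReal.ofReal_le_ofReal (mul_le_mul_of_nonneg_right hle (hω0 x hx))).trans ?_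
      exact Finset.single_le_sum (f := fun s => ENNReal.ofReal (Real.exp (2 * ε n) *
        ((ε n)⁻¹ * Real.exp (-(2 * |x - s| / ε n))) * ω x)) (fun _ _ => zero_le)
        (hS.mem_toFinset.2 hs)
    · intro s _
      exact (AEMeasurable.mul (by fun_prop) hωi.aemeasurable).ennreal_ofReal
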